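/- Consider the model family α_u(t) = (t, (1+u)t + t³) of deformations of a lightlike ordinary inflection, write f_u(t) = (1+u)t + t³, and let κ_u denote the Minkowski curvature of α_u (defined at non-lightlike parameters). There exist ε, δ > 0 such that for every u with 0 < |u| < δ: (i) the lightlike points of α_u in (−ε, ε), i.e. parameters t with f_u'(t)² = 1, are exactly t = ±√(−u/3) if u < 0 and there are none if u > 0; (ii) the only zero in (−ε, ε) of the inflection function ⟨α_u''(t), α_u'(t)^⊥⟩ = f_u''(t) = 6t is t = 0; (iii) if 0 < u < δ then κ_u' has exactly two zeros in (−ε, ε), they are of opposite sign, and at both of them κ_u·κ_u'' < 0 (two outward vertices); (iv) if −δ < u < 0 then κ_u' has no zeros in (−ε, ε) away from the lightlike points. -/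

import Mathlib

open Filter Topology

namespace LightlikeInflection

/-- The pseudo-norm `f_u'(t)² - 1` of the velocity of `α_u`. -/
def speed (u t : ℝ) : ℝ := (1 + u + 3 * t ^ 2) ^ 2 - 1

/-- The polynomial factor of the derivative of the curvature of `α_u`. -/
def vertexPoly (u t : ℝ) : ℝ := u ^ 2 + 2 * u - 12 * (1 + u) * t ^ 2 - 45 * t ^ 4

lemma hasDerivAt_speed (u t : ℝ) :
    HasDerivAt (speed u) (12 * t * (1 + u + 3 * t ^ 2)) t := by
  have h := ((((hasDerivAt_pow 2 t).const_mul 3).const_add (1 + u)).pow 2).sub_const 1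
  exact h.congr_deriv (by simp; ring)

lemma hasDerivAt_vertexPoly (u t : ℝ) :
    HasDerivAt (vertexPoly u) (-(24 * (1 + u) * t + 180 * t ^ 3)) t := by
  have h := (((hasDerivAt_pow 2 t).const_mul (12 * (1 + u))).const_sub (u ^ 2 + 2 * u)).sub
    ((hasDerivAt_pow 4 t).const_mul 45)
  exact h.congr_deriv (by simp; ring)

lemma deriv_model (u : ℝ) :
    deriv (fun t : ℝ => (1 + u) * t + t ^ 3) = fun t => 1 + u + 3 * t ^ 2 := by
  funext t
  have h := ((hasDerivAt_id t).const_mul (1 + u)).add (hasDerivAt_pow 3 t)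
  exact (h.congr_deriv (by simp)).deriv

lemma iteratedDeriv_two_model (u : ℝ) :
    iteratedDeriv 2 (fun t : ℝ => (1 + u) * t + t ^ 3) = fun t => 6 * t := by
  rw [iteratedDeriv_succ, iteratedDeriv_one, deriv_model]
  funext t
  have h := ((hasDerivAt_pow 2 t).const_mul 3).const_add (1 + u)
  exact (h.congr_deriv (by simp; ring)).deriv

lemma hasDerivAt_curvature {u t : ℝ} (hq : speed u t ≠ 0) :
    HasDerivAt (fun t => 6 * t / |speed u t| ^ ((3 : ℝ) / 2))
      (6 * (SignType.sign (speed u t) : ℝ) * vertexPoly u t * |speed u t| ^ (-(5 : ℝ) / 2)) t := by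
  have hr : 0 < |speed u t| := abs_pos.mpr hq
  have hf : (fun t => 6 * t / |speed u t| ^ ((3 : ℝ) / 2)) =
      fun t => 6 * t * |speed u t| ^ (-(3 : ℝ) / 2) := by
    funext x
    rw [neg_div, Real.rpow_neg (abs_nonneg _), div_eq_mul_inv]
  rw [hf]
  have h := ((hasDerivAt_id t).const_mul 6).mul
    (((hasDerivAt_abs hq).comp t (hasDerivAt_speed u t)).rpow_const (p := -(3 : ℝ) / 2) (Or.inl hr.ne'))
  refine h.congr_deriv ?_
  have hexp : |speed u t| ^ (-(3 : ℝ) / 2) = |speed u t| * |speed u t| ^ (-(5 : ℝ) / 2) := by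
    rw [show -(3 : ℝ) / 2 = 1 + -(5 : ℝ) / 2 by norm_num, Real.rpow_add hr, Real.rpow_one]
  simp only [Function.comp_apply, id]
  rw [show -(3 : ℝ) / 2 - 1 = -(5 : ℝ) / 2 by norm_num, hexp]
  generalize |speed u t| ^ (-(5 : ℝ) / 2) = c
  rw [← sign_mul_self (speed u t)]
  generalize (SignType.sign (speed u t) : ℝ) = σ
  simp only [speed, vertexPoly]
  ring

lemma speed_pos {u : ℝ} (hu : 0 < u) (t : ℝ) : 0 < speed u t := by
  unfold speed
  nlinarith [sq_nonneg t]

lemma vertexPoly_sub (u s t : ℝ) :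
    vertexPoly u s - vertexPoly u t =
      (t ^ 2 - s ^ 2) * (12 * (1 + u) + 45 * (s ^ 2 + t ^ 2)) := by
  unfold vertexPoly
  ring

lemma vertexPoly_eq_zero_iff {u s t : ℝ} (hu : 0 < u) (hs : vertexPoly u s = 0) :
    vertexPoly u t = 0 ↔ t = -s ∨ t = s := by
  have h := vertexPoly_sub u s t
  have hpos : 12 * (1 + u) + 45 * (s ^ 2 + t ^ 2) ≠ 0 := by positivity
  rw [or_comm, ← sq_eq_sq_iff_eq_or_eq_neg]
  constructor
  · intro ht
    rw [hs, ht, sub_zero, eq_comm, mul_eq_zero] at h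
    linarith [h.resolve_right hpos]
  · intro ht
    rw [ht, sub_self, zero_mul, hs] at h
    linarith

lemma exists_vertexPoly_eq_zero {u : ℝ} (hu : 0 < u) (hu1 : u < 1) :
    ∃ s : ℝ, 0 < s ∧ s < 1 ∧ vertexPoly u s = 0 := by
  have hc : ContinuousOn (vertexPoly u) (Set.Icc 0 1) := fun t _ =>
    (hasDerivAt_vertexPoly u t).continuousAt.continuousWithinAt
  obtain ⟨s, hs, h⟩ := intermediate_value_Ioo' zero_le_one hc
    (show (0 : ℝ) ∈ Set.Ioo (vertexPoly u 1) (vertexPoly u 0) by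
      constructor <;> unfold vertexPoly <;> nlinarith)
  exact ⟨s, hs.1, hs.2, h⟩

lemma vertexPoly_neg {u : ℝ} (hu : u < 0) (hu1 : -1 < u) (t : ℝ) : vertexPoly u t < 0 := by
  unfold vertexPoly
  have h1 : 0 ≤ (1 + u) * t ^ 2 := mul_nonneg (by linarith) (sq_nonneg t)
  have h2 : 0 ≤ t ^ 4 := by positivity
  nlinarith

lemma deriv_curvature {u t : ℝ} (hq : speed u t ≠ 0) :
    deriv (fun t => 6 * t / |speed u t| ^ ((3 : ℝ) / 2)) t =
      6 * (SignType.sign (speed u t) : ℝ) * vertexPoly u t * |speed u t| ^ (-(5 : ℝ) / 2) :=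
  (hasDerivAt_curvature hq).deriv

lemma deriv_curvature_eq_zero_iff {u t : ℝ} (hq : speed u t ≠ 0) :
    deriv (fun t => 6 * t / |speed u t| ^ ((3 : ℝ) / 2)) t = 0 ↔ vertexPoly u t = 0 := by
  have h := (Real.rpow_pos_of_pos (abs_pos.mpr hq) (-(5 : ℝ) / 2)).ne'
  have hs : (SignType.sign (speed u t) : ℝ) ≠ 0 := by
    intro h0
    have := sign_mul_self (speed u t)
    rw [h0, zero_mul, eq_comm, abs_eq_zero] at this
    exact hq this
  rw [deriv_curvature hq]
  simp [h, hs]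

/-- For `u > 0`, every nonzero vertex is outward. -/
lemma curvature_mul_iteratedDeriv_two_neg {u t : ℝ} (hu : 0 < u) (ht : t ≠ 0)
    (h0 : vertexPoly u t = 0) :
    6 * t / |speed u t| ^ ((3 : ℝ) / 2) *
      iteratedDeriv 2 (fun t => 6 * t / |speed u t| ^ ((3 : ℝ) / 2)) t < 0 := by
  have hd : deriv (fun t => 6 * t / |speed u t| ^ ((3 : ℝ) / 2)) =
      fun t => 6 * vertexPoly u t * speed u t ^ (-(5 : ℝ) / 2) := by
    funext x
    have hx := speed_pos hu x
    rw [deriv_curvature hx.ne', sign_pos hx, abs_of_pos hx]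
    simp
  have hq := speed_pos hu t
  have h := ((hasDerivAt_vertexPoly u t).const_mul 6).mul
    ((hasDerivAt_speed u t).rpow_const (p := -(5 : ℝ) / 2) (Or.inl hq.ne'))
  rw [iteratedDeriv_succ, iteratedDeriv_one, hd]
  erw [h.deriv]
  rw [h0, abs_of_pos hq]
  have ha : 0 < speed u t ^ (-(5 : ℝ) / 2) := Real.rpow_pos_of_pos hq _
  have hb : 0 < speed u t ^ ((3 : ℝ) / 2) := Real.rpow_pos_of_pos hq _
  have ht2 : 0 < t ^ 2 := by positivity
  have key : 0 < 36 * (24 * (1 + u) * t ^ 2 + 180 * t ^ 4) * speed u t ^ (-(5 : ℝ) / 2) /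
      speed u t ^ ((3 : ℝ) / 2) := by positivity
  calc _ = -(36 * (24 * (1 + u) * t ^ 2 + 180 * t ^ 4) * speed u t ^ (-(5 : ℝ) / 2) /
      speed u t ^ ((3 : ℝ) / 2)) := by ring
    _ < 0 := neg_lt_zero.mpr key

lemma sq_eq_one_iff_lightlike {u : ℝ} (hu0 : u ≠ 0) (hu1 : -1 < u) (t : ℝ) :
    (1 + u + 3 * t ^ 2) ^ 2 = 1 ↔ u < 0 ∧ (t = √(-u / 3) ∨ t = -√(-u / 3)) := by
  rw [← sq_eq_sq_iff_eq_or_eq_neg]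
  constructor
  · intro h
    have h1 : (u + 3 * t ^ 2) * (2 + u + 3 * t ^ 2) = 0 := by linarith
    have h2 : 2 + u + 3 * t ^ 2 ≠ 0 := by nlinarith [sq_nonneg t]
    have h3 := (mul_eq_zero.mp h1).resolve_right h2
    have h4 : u < 0 := lt_of_le_of_ne (by nlinarith [sq_nonneg t]) hu0
    refine ⟨h4, ?_⟩
    rw [Real.sq_sqrt (by linarith)]
    linarith
  · rintro ⟨h4, h⟩
    rw [Real.sq_sqrt (by linarith)] at h
    rw [h]
    ring

end LightlikeInflection

open LightlikeInflection

/-- Behavior of the model family α_u(t) = (t, (1+u)t + t³) of deformations of a lightlike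
ordinary inflection: for small u ≠ 0 the lightlike points are exactly t = ±√(-u/3) if u < 0
and there are none if u > 0; the only inflection parameter is t = 0; for u > 0 there are
exactly two vertices, of opposite sign, both outward; for u < 0 there are no vertices away
from the lightlike points. -/
theorem stmt_9 (f : ℝ → ℝ → ℝ) (hf : ∀ u t, f u t = (1 + u) * t + t^3)
    (κ : ℝ → ℝ → ℝ)
    (hκ : ∀ u t, κ u t =
      iteratedDeriv 2 (f u) t / |(deriv (f u) t)^2 - 1| ^ ((3:ℝ)/2)) :
    ∃ ε > 0, ∃ δ > 0, ∀ u : ℝ, 0 < |u| → |u| < δ →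
      ((∀ t, |t| < ε → ((deriv (f u) t)^2 = 1 ↔
          u < 0 ∧ (t = Real.sqrt (-u/3) ∨ t = -Real.sqrt (-u/3)))) ∧
       (∀ t, |t| < ε → (iteratedDeriv 2 (f u) t = 0 ↔ t = 0)) ∧
       (0 < u → ∃ t₁ t₂ : ℝ, t₁ < 0 ∧ 0 < t₂ ∧ |t₁| < ε ∧ |t₂| < ε ∧
          (∀ t, |t| < ε → (deriv (κ u) t = 0 ↔ (t = t₁ ∨ t = t₂))) ∧
          κ u t₁ * iteratedDeriv 2 (κ u) t₁ < 0 ∧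
          κ u t₂ * iteratedDeriv 2 (κ u) t₂ < 0) ∧
       (u < 0 → ∀ t, |t| < ε → (deriv (f u) t)^2 ≠ 1 → deriv (κ u) t ≠ 0)) := by
  refine ⟨1, one_pos, 1, one_pos, fun u hu hu1 => ?_⟩
  have hu0 : u ≠ 0 := abs_pos.mp hu
  obtain ⟨hul, hur⟩ := abs_lt.mp hu1
  have hf' : f u = fun t => (1 + u) * t + t ^ 3 := funext (hf u)
  have hd : deriv (f u) = fun t => 1 + u + 3 * t ^ 2 := by rw [hf', deriv_model]
  have hdd : iteratedDeriv 2 (f u) = fun t => 6 * t := by rw [hf', iteratedDeriv_two_model]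
  have hκ' : κ u = fun t => 6 * t / |speed u t| ^ ((3 : ℝ) / 2) := by
    funext t
    rw [hκ, hd, hdd]
    rfl
  rw [hκ', hd, hdd]
  refine ⟨fun t _ => sq_eq_one_iff_lightlike hu0 hul t, fun t _ => by simp, fun hpos => ?_,
    fun hneg t _ hq => ?_⟩
  · obtain ⟨s, hs0, hs1, hs⟩ := exists_vertexPoly_eq_zero hpos hur
    have hs' : vertexPoly u (-s) = 0 := (vertexPoly_eq_zero_iff hpos hs).mpr (Or.inl rfl)
    have habs : |s| < 1 := by rwa [abs_of_pos hs0]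
    refine ⟨-s, s, neg_lt_zero.mpr hs0, hs0, by rwa [abs_neg], habs, fun t _ => ?_,
      curvature_mul_iteratedDeriv_two_neg hpos (neg_ne_zero.mpr hs0.ne') hs',
      curvature_mul_iteratedDeriv_two_neg hpos hs0.ne' hs⟩
    rw [deriv_curvature_eq_zero_iff (speed_pos hpos t).ne', vertexPoly_eq_zero_iff hpos hs]
  · rw [Ne, deriv_curvature_eq_zero_iff (sub_ne_zero.mpr hq)]
    exact (vertexPoly_neg hneg hul t).ne
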